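/- Let 1<p<∞, p′ = p/(p−1), let σ be a weight on ℝ^d with σ ∈ A_{p′}, let 𝒟 be the standard dyadic grid and I₀ ∈ 𝒟 a dyadic cube. Define the stopping cubes 𝒮(I₀) := ⋃_{j≥0} 𝒮_j(I₀), where 𝒮₀(I₀) := {I₀} and 𝒮_{j+1}(I₀) := ⋃_{I ∈ 𝒮_j(I₀)} 𝒞(I), with 𝒞(I) the maximal dyadic cubes I′ ⊆ I satisfying 𝔼_{I′}σ > 4·𝔼_I σ. Then Σ_{S ∈ 𝒮(I₀)} σ(S) ≤ C(p,d) ‖σ‖_{A_{p′}} σ(I₀). -/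

import Mathlib

open MeasureTheory Set ENNReal

noncomputable section

/-- An axis-parallel cube in `ℝ^d` with corner `x` and side length `h`. -/
def cube (d : ℕ) (x : Fin d → ℝ) (h : ℝ) : Set (Fin d → ℝ) :=
  Set.univ.pi fun i => Set.Ico (x i) (x i + h)

/-- The average of (the nonnegative part of) `w` over a set `I`, valued in `ℝ≥0∞`. -/
def lavg (d : ℕ) (w : (Fin d → ℝ) → ℝ) (I : Set (Fin d → ℝ)) : ℝ≥0∞ :=
  (volume I)⁻¹ * ∫⁻ y in I, ENNReal.ofReal (w y)

/-- The `A_p` characteristic of a weight `w` on `ℝ^d`: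
the supremum over all cubes `I` of `(|I|⁻¹∫_I w)·(|I|⁻¹∫_I w^{-1/(p-1)})^{p-1}`. -/
def ApChar (d : ℕ) (p : ℝ) (w : (Fin d → ℝ) → ℝ) : ℝ≥0∞ :=
  ⨆ (x : Fin d → ℝ) (h : Set.Ioi (0:ℝ)),
    lavg d w (cube d x h) *
      (lavg d (fun y => w y ^ (-1 / (p - 1))) (cube d x h)) ^ (p - 1)

/-- A weight on `ℝ^d`: a measurable, locally integrable, a.e. positive function. -/
def IsWeight (d : ℕ) (w : (Fin d → ℝ) → ℝ) : Prop :=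
  Measurable w ∧ LocallyIntegrable w volume ∧ ∀ᵐ x : Fin d → ℝ, 0 < w x

/-- The standard dyadic cube `2^{-k}(n + [0,1)^d)` in `ℝ^d`. -/
def dyadicCube (d : ℕ) (k : ℤ) (n : Fin d → ℤ) : Set (Fin d → ℝ) :=
  Set.univ.pi fun i => Set.Ico ((n i : ℝ) * (2:ℝ) ^ (-k)) (((n i : ℝ) + 1) * (2:ℝ) ^ (-k))

/-- `(k', n')` indexes a *stopping child* of the dyadic cube indexed by `(k, n)` for the
density `σ`: a maximal dyadic subcube `I' ⊆ I` with `𝔼_{I'} σ > 4 𝔼_I σ`. -/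
def IsStoppingChild (d : ℕ) (σ : (Fin d → ℝ) → ℝ) (k : ℤ) (n : Fin d → ℤ)
    (k' : ℤ) (n' : Fin d → ℤ) : Prop :=
  dyadicCube d k' n' ⊆ dyadicCube d k n ∧
  4 * lavg d σ (dyadicCube d k n) < lavg d σ (dyadicCube d k' n') ∧
  ∀ (k'' : ℤ) (n'' : Fin d → ℤ),
    dyadicCube d k'' n'' ⊆ dyadicCube d k n →
    4 * lavg d σ (dyadicCube d k n) < lavg d σ (dyadicCube d k'' n'') →
    dyadicCube d k' n' ⊆ dyadicCube d k'' n'' →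
    dyadicCube d k'' n'' = dyadicCube d k' n'

/-- The `j`-th generation of stopping cubes below the dyadic cube indexed by `(k, n)`:
`𝒮₀ = {I₀}` and `𝒮_{j+1}` consists of the stopping children of the cubes of `𝒮_j`. -/
def stoppingGen (d : ℕ) (σ : (Fin d → ℝ) → ℝ) (k : ℤ) (n : Fin d → ℤ) :
    ℕ → Set (ℤ × (Fin d → ℤ))
  | 0 => {(k, n)}
  | j + 1 => {q | ∃ p ∈ stoppingGen d σ k n j, IsStoppingChild d σ p.1 p.2 q.1 q.2}

lemma dyadicCube_eq_cube (d : ℕ) (k : ℤ) (n : Fin d → ℤ) :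
    dyadicCube d k n = cube d (fun i => (n i : ℝ) * (2:ℝ) ^ (-k)) ((2:ℝ) ^ (-k)) := by
  simp only [dyadicCube, cube, add_mul, one_mul]

lemma volume_dyadicCube (d : ℕ) (k : ℤ) (n : Fin d → ℤ) :
    volume (dyadicCube d k n) = ENNReal.ofReal ((2:ℝ) ^ (-k)) ^ d := by
  rw [dyadicCube, Real.volume_pi_Ico]
  simp [add_mul]

lemma volume_dyadicCube_ne_zero (d : ℕ) (k : ℤ) (n : Fin d → ℤ) :
    volume (dyadicCube d k n) ≠ 0 := by
  rw [volume_dyadicCube]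
  exact pow_ne_zero _ (ENNReal.ofReal_pos.2 (by positivity)).ne'

lemma volume_dyadicCube_ne_top (d : ℕ) (k : ℤ) (n : Fin d → ℤ) :
    volume (dyadicCube d k n) ≠ ⊤ := by
  rw [volume_dyadicCube]
  exact ENNReal.pow_ne_top ENNReal.ofReal_ne_top

lemma measurableSet_dyadicCube (d : ℕ) (k : ℤ) (n : Fin d → ℤ) :
    MeasurableSet (dyadicCube d k n) :=
  MeasurableSet.univ_pi fun _ => measurableSet_Ico

lemma dyadicCube_subset_of_le {d : ℕ} {k k' : ℤ} {n n' : Fin d → ℤ} (hk : k ≤ k')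
    {x : Fin d → ℝ} (hx : x ∈ dyadicCube d k n) (hx' : x ∈ dyadicCube d k' n') :
    dyadicCube d k' n' ⊆ dyadicCube d k n := by
  obtain ⟨m, rfl⟩ := Int.le.dest hk
  refine Set.pi_mono fun i _ => ?_
  obtain ⟨h1, h2⟩ := hx i (mem_univ i)
  obtain ⟨h3, h4⟩ := hx' i (mem_univ i)
  set t : ℝ := (2:ℝ) ^ (-(k + m)) with ht
  have htpos : 0 < t := by positivity
  have hkt : (2:ℝ) ^ (-k) = 2 ^ m * t := by
    rw [ht, ← zpow_natCast, ← zpow_add₀ (by norm_num)]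
    congr 1
    ring
  rw [hkt] at h1 h2 ⊢
  have h5 : n i * 2 ^ m < n' i + 1 := by
    have : (n i : ℝ) * 2 ^ m < n' i + 1 := lt_of_mul_lt_mul_right (by linarith) htpos.le
    exact_mod_cast this
  have h6 : n' i < (n i + 1) * 2 ^ m := by
    have : (n' i : ℝ) < (n i + 1) * 2 ^ m := lt_of_mul_lt_mul_right (by linarith) htpos.le
    exact_mod_cast this
  have h7 : (n i : ℝ) * 2 ^ m ≤ n' i := by exact_mod_cast Int.lt_add_one_iff.1 h5
  have h8 : (n' i : ℝ) + 1 ≤ (n i + 1) * 2 ^ m := by exact_mod_cast Int.add_one_le_iff.2 h6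
  refine Set.Ico_subset_Ico ?_ ?_
  · rw [← mul_assoc]
    gcongr
  · rw [← mul_assoc]
    gcongr

lemma corner_mem_dyadicCube (d : ℕ) (k : ℤ) (n : Fin d → ℤ) :
    (fun i => (n i : ℝ) * (2:ℝ) ^ (-k)) ∈ dyadicCube d k n := by
  intro i _
  have : (0:ℝ) < 2 ^ (-k) := by positivity
  exact ⟨le_rfl, by dsimp only; linarith⟩

lemma dyadicCube_index_injective {d : ℕ} (hd : d ≠ 0) {k k' : ℤ} {n n' : Fin d → ℤ}
    (h : dyadicCube d k n = dyadicCube d k' n') : (k, n) = (k', n') := by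
  have hk : k = k' := by
    have hv := volume_dyadicCube d k n
    rw [h, volume_dyadicCube] at hv
    have h1 := (ENNReal.pow_right_strictMono hd).injective hv
    rw [ENNReal.ofReal_eq_ofReal_iff (by positivity) (by positivity)] at h1
    have h2 := zpow_right_injective₀ (by norm_num : (0:ℝ) < 2) (by norm_num) h1
    omega
  subst hk
  congr 1
  ext i
  have hpos : (0:ℝ) < 2 ^ (-k) := by positivity
  have h1 := (h ▸ corner_mem_dyadicCube d k n : _ ∈ dyadicCube d k n') i (mem_univ i)
  have h2 := (h ▸ corner_mem_dyadicCube d k n' : _ ∈ dyadicCube d k n) i (mem_univ i)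
  have h3 : (n' i : ℝ) ≤ n i := le_of_mul_le_mul_right h1.1 hpos
  have h4 : (n i : ℝ) ≤ n' i := le_of_mul_le_mul_right h2.1 hpos
  exact_mod_cast le_antisymm h4 h3

/-- The index set of the stopping children of the dyadic cube indexed by `q`. -/
def stoppingChildren (d : ℕ) (σ : (Fin d → ℝ) → ℝ) (q : ℤ × (Fin d → ℤ)) :
    Set (ℤ × (Fin d → ℤ)) :=
  {r | IsStoppingChild d σ q.1 q.2 r.1 r.2}

lemma pairwiseDisjoint_stoppingChildren (d : ℕ) (σ : (Fin d → ℝ) → ℝ) (q : ℤ × (Fin d → ℤ)) :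
    (stoppingChildren d σ q).PairwiseDisjoint fun r => dyadicCube d r.1 r.2 := by
  rintro ⟨k, n⟩ ⟨h1, h2, h3⟩ ⟨k', n'⟩ ⟨h1', h2', h3'⟩ hne
  dsimp only at *
  rcases eq_or_ne d 0 with rfl | hd
  · have huniv : ∀ k n, dyadicCube 0 k n = univ := fun k n =>
      eq_univ_of_forall fun x i => i.elim0
    simp only [huniv] at h2
    have : lavg 0 σ univ ≤ 4 * lavg 0 σ univ :=
      le_mul_of_one_le_left zero_le (by norm_num)
    exact absurd h2 this.not_gt
  · refine Set.disjoint_left.2 fun x hx hx' => hne ?_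
    apply dyadicCube_index_injective hd
    rcases le_total k k' with hk | hk
    · exact h3' k n h1 h2 (dyadicCube_subset_of_le hk hx hx')
    · exact (h3 k' n' h1' h2' (dyadicCube_subset_of_le hk hx' hx)).symm

lemma rpow_volume_mul_setLIntegral_le {d : ℕ} {p : ℝ} (hp : 1 < p) {σ : (Fin d → ℝ) → ℝ}
    (hσ : Measurable σ) (hpos : ∀ᵐ x : Fin d → ℝ, 0 < σ x) (k : ℤ) (n : Fin d → ℤ)
    {E : Set (Fin d → ℝ)} (hE : E ⊆ dyadicCube d k n) :
    volume E ^ (p / (p - 1)) * ∫⁻ y in dyadicCube d k n, ENNReal.ofReal (σ y) ≤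
      ApChar d (p / (p - 1)) σ * volume (dyadicCube d k n) ^ (p / (p - 1)) *
        ∫⁻ y in E, ENNReal.ofReal (σ y) := by
  have hp1 : 0 < p - 1 := by linarith
  have hq1 : p / (p - 1) - 1 = 1 / (p - 1) := by field_simp; ring
  have hconj : (p / (p - 1)).HolderConjugate p :=
    (Real.HolderConjugate.conjExponent hp).symm
  set q := p / (p - 1) with hq
  have hqpos : 0 < q := hconj.pos
  have hq1pos : 0 < q - 1 := by rw [hq1]; positivity
  set Q := dyadicCube d k n with hQ
  set τ : (Fin d → ℝ) → ℝ := fun y => σ y ^ (-1 / (q - 1)) with hτ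
  have hτm : Measurable τ := hσ.pow_const _
  have hAp : lavg d σ Q * lavg d τ Q ^ (q - 1) ≤ ApChar d q σ := by
    rw [hQ, dyadicCube_eq_cube]
    exact le_iSup₂_of_le (f := fun (x : Fin d → ℝ) (h : Set.Ioi (0:ℝ)) =>
      lavg d σ (cube d x h) * (lavg d (fun y => σ y ^ (-1 / (q - 1))) (cube d x h)) ^ (q - 1))
      _ ⟨(2:ℝ) ^ (-k), mem_Ioi.2 (by positivity)⟩ le_rfl
  have hV0 : volume Q ≠ 0 := volume_dyadicCube_ne_zero d k n
  have hVt : volume Q ≠ ⊤ := volume_dyadicCube_ne_top d k n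
  have hholder : volume E ^ q ≤
      (∫⁻ y in E, ENNReal.ofReal (σ y)) * (∫⁻ y in Q, ENNReal.ofReal (τ y)) ^ (q - 1) := by
    have h1 : volume E ≤ ∫⁻ y in E,
        ((fun y => ENNReal.ofReal (σ y) ^ (1 / q)) * fun y => ENNReal.ofReal (τ y) ^ (1 / p)) y := by
      rw [← setLIntegral_one]
      refine lintegral_mono_ae ?_
      filter_upwards [ae_restrict_of_ae hpos] with y hy
      have hexp : 1 / q + -1 / (q - 1) * (1 / p) = 0 := by
        rw [hq1, hq]; field_simp; ring
      rw [Pi.mul_apply, ENNReal.ofReal_rpow_of_pos hy, hτ,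
        ENNReal.ofReal_rpow_of_pos (Real.rpow_pos_of_pos hy _),
        ← ENNReal.ofReal_mul (by positivity), ← Real.rpow_mul hy.le, ← Real.rpow_add hy, hexp]
      simp
    have h2 := h1.trans (ENNReal.lintegral_mul_le_Lp_mul_Lq (volume.restrict E) hconj
      (hσ.ennreal_ofReal.pow_const _).aemeasurable (hτm.ennreal_ofReal.pow_const _).aemeasurable)
    simp only [← ENNReal.rpow_mul, one_div_mul_cancel hqpos.ne',
      one_div_mul_cancel (by linarith : p ≠ 0), ENNReal.rpow_one] at h2
    have h3 := ENNReal.rpow_le_rpow h2 hqpos.le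
    rw [ENNReal.mul_rpow_of_nonneg _ _ hqpos.le, ← ENNReal.rpow_mul, ← ENNReal.rpow_mul,
      one_div_mul_cancel hqpos.ne', ENNReal.rpow_one,
      show 1 / p * q = q - 1 by rw [hq1, hq]; field_simp] at h3
    refine h3.trans ?_
    gcongr
  have hmul : (∫⁻ y in Q, ENNReal.ofReal (σ y)) * (∫⁻ y in Q, ENNReal.ofReal (τ y)) ^ (q - 1) ≤
      ApChar d q σ * volume Q ^ q := by
    have hint : ∀ w : (Fin d → ℝ) → ℝ,
        ∫⁻ y in Q, ENNReal.ofReal (w y) = lavg d w Q * volume Q := fun w => by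
      rw [lavg, mul_right_comm, ENNReal.inv_mul_cancel hV0 hVt, one_mul]
    rw [hint σ, hint τ, ENNReal.mul_rpow_of_nonneg _ _ hq1pos.le]
    calc _ = lavg d σ Q * lavg d τ Q ^ (q - 1) * (volume Q ^ (1:ℝ) * volume Q ^ (q - 1)) := by
          rw [ENNReal.rpow_one]; ring
      _ ≤ _ := by
          rw [← ENNReal.rpow_add _ _ hV0 hVt, add_sub_cancel]
          gcongr
  calc _ ≤ ((∫⁻ y in E, ENNReal.ofReal (σ y)) * (∫⁻ y in Q, ENNReal.ofReal (τ y)) ^ (q - 1)) *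
        ∫⁻ y in Q, ENNReal.ofReal (σ y) := by gcongr
    _ = ((∫⁻ y in Q, ENNReal.ofReal (σ y)) * (∫⁻ y in Q, ENNReal.ofReal (τ y)) ^ (q - 1)) *
        ∫⁻ y in E, ENNReal.ofReal (σ y) := by ring
    _ ≤ _ := by gcongr

/-- The part of the dyadic cube indexed by `q` not covered by its stopping children. -/
def stoppingRest (d : ℕ) (σ : (Fin d → ℝ) → ℝ) (q : ℤ × (Fin d → ℤ)) : Set (Fin d → ℝ) :=
  dyadicCube d q.1 q.2 \ ⋃ r ∈ stoppingChildren d σ q, dyadicCube d r.1 r.2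

lemma biUnion_stoppingChildren_subset (d : ℕ) (σ : (Fin d → ℝ) → ℝ) (q : ℤ × (Fin d → ℤ)) :
    ⋃ r ∈ stoppingChildren d σ q, dyadicCube d r.1 r.2 ⊆ dyadicCube d q.1 q.2 :=
  iUnion₂_subset fun _ hr => hr.1

lemma measurableSet_biUnion_stoppingChildren (d : ℕ) (σ : (Fin d → ℝ) → ℝ)
    (q : ℤ × (Fin d → ℤ)) :
    MeasurableSet (⋃ r ∈ stoppingChildren d σ q, dyadicCube d r.1 r.2) :=
  MeasurableSet.biUnion (to_countable _) fun r _ => measurableSet_dyadicCube d r.1 r.2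

lemma setLIntegral_stoppingRest_add_tsum (d : ℕ) (σ : (Fin d → ℝ) → ℝ) (q : ℤ × (Fin d → ℤ)) :
    (∫⁻ y in stoppingRest d σ q, ENNReal.ofReal (σ y)) +
        ∑' r : stoppingChildren d σ q, ∫⁻ y in dyadicCube d r.1.1 r.1.2, ENNReal.ofReal (σ y) =
      ∫⁻ y in dyadicCube d q.1 q.2, ENNReal.ofReal (σ y) := by
  rw [← lintegral_biUnion (to_countable _) (fun r _ => measurableSet_dyadicCube d r.1 r.2)
    (pairwiseDisjoint_stoppingChildren d σ q), add_comm, stoppingRest]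
  have := lintegral_inter_add_sdiff (μ := volume) (fun y => ENNReal.ofReal (σ y))
    (dyadicCube d q.1 q.2) (measurableSet_biUnion_stoppingChildren d σ q)
  rwa [inter_eq_self_of_subset_right (biUnion_stoppingChildren_subset d σ q)] at this

lemma setLIntegral_dyadicCube_ne_top {d : ℕ} {σ : (Fin d → ℝ) → ℝ}
    (hσ : LocallyIntegrable σ volume) (k : ℤ) (n : Fin d → ℤ) :
    ∫⁻ y in dyadicCube d k n, ENNReal.ofReal (σ y) ≠ ⊤ := by
  have hsub : dyadicCube d k n ⊆ Set.univ.pi fun i =>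
      Set.Icc ((n i : ℝ) * (2:ℝ) ^ (-k)) (((n i : ℝ) + 1) * (2:ℝ) ^ (-k)) :=
    Set.pi_mono fun i _ => Set.Ico_subset_Icc_self
  have hint := (hσ.integrableOn_isCompact (isCompact_univ_pi fun i => isCompact_Icc)).mono_set hsub
  exact ((lintegral_ofReal_le_lintegral_enorm _).trans_lt hint.2).ne

lemma setLIntegral_dyadicCube_ne_zero {d : ℕ} {σ : (Fin d → ℝ) → ℝ} (hσ : Measurable σ)
    (hpos : ∀ᵐ x : Fin d → ℝ, 0 < σ x) (k : ℤ) (n : Fin d → ℤ) :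
    ∫⁻ y in dyadicCube d k n, ENNReal.ofReal (σ y) ≠ 0 := by
  intro h
  rw [lintegral_eq_zero_iff hσ.ennreal_ofReal] at h
  refine volume_dyadicCube_ne_zero d k n ?_
  rw [← Measure.restrict_eq_zero, ← ae_eq_bot, ← Filter.eventually_false_iff_eq_bot]
  filter_upwards [h, ae_restrict_of_ae hpos] with y h1 h2
  exact (ENNReal.ofReal_pos.2 h2).ne' h1

lemma four_mul_volume_biUnion_stoppingChildren_le {d : ℕ} {σ : (Fin d → ℝ) → ℝ}
    (hσ : IsWeight d σ) (q : ℤ × (Fin d → ℤ)) :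
    4 * volume (⋃ r ∈ stoppingChildren d σ q, dyadicCube d r.1 r.2) ≤
      volume (dyadicCube d q.1 q.2) := by
  obtain ⟨hm, hloc, hpos⟩ := hσ
  set a := lavg d σ (dyadicCube d q.1 q.2) with ha
  have hV0 := volume_dyadicCube_ne_zero d q.1 q.2
  have hVt := volume_dyadicCube_ne_top d q.1 q.2
  have ha0 : a ≠ 0 := mul_ne_zero (ENNReal.inv_ne_zero.2 hVt)
    (setLIntegral_dyadicCube_ne_zero hm hpos _ _)
  have hat : a ≠ ⊤ := ENNReal.mul_ne_top (ENNReal.inv_ne_top.2 hV0)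
    (setLIntegral_dyadicCube_ne_top hloc _ _)
  have hint : a * volume (dyadicCube d q.1 q.2) =
      ∫⁻ y in dyadicCube d q.1 q.2, ENNReal.ofReal (σ y) := by
    rw [ha, lavg, mul_right_comm, ENNReal.inv_mul_cancel hV0 hVt, one_mul]
  rw [← ENNReal.mul_le_mul_iff_right ha0 hat, hint, ← setLIntegral_stoppingRest_add_tsum d σ q,
    measure_biUnion (to_countable _) (pairwiseDisjoint_stoppingChildren d σ q)
      (fun r _ => measurableSet_dyadicCube d r.1 r.2), ← mul_assoc, ← ENNReal.tsum_mul_left]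
  refine le_add_left (ENNReal.tsum_le_tsum fun r => ?_)
  rw [mul_comm a 4]
  calc _ ≤ lavg d σ (dyadicCube d r.1.1 r.1.2) * volume (dyadicCube d r.1.1 r.1.2) := by
        gcongr
        exact r.2.2.1.le
    _ = _ := by
        rw [lavg, mul_right_comm, ENNReal.inv_mul_cancel (volume_dyadicCube_ne_zero _ _ _)
          (volume_dyadicCube_ne_top _ _ _), one_mul]

lemma volume_dyadicCube_le_stoppingRest {d : ℕ} {σ : (Fin d → ℝ) → ℝ}
    (hσ : IsWeight d σ) (q : ℤ × (Fin d → ℤ)) :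
    volume (dyadicCube d q.1 q.2) ≤ 2 * volume (stoppingRest d σ q) := by
  have hVt := volume_dyadicCube_ne_top d q.1 q.2
  have h4 := four_mul_volume_biUnion_stoppingChildren_le hσ q
  have hadd := measure_inter_add_sdiff (μ := volume) (dyadicCube d q.1 q.2)
    (measurableSet_biUnion_stoppingChildren d σ q)
  rw [inter_eq_self_of_subset_right (biUnion_stoppingChildren_subset d σ q)] at hadd
  change _ + volume (stoppingRest d σ q) = _ at hadd
  rw [← hadd] at h4 hVt ⊢
  clear hadd
  generalize volume (⋃ r ∈ stoppingChildren d σ q, dyadicCube d r.1 r.2) = U at *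
  generalize volume (stoppingRest d σ q) = E at *
  obtain ⟨hU, hE⟩ := ENNReal.add_ne_top.1 hVt
  lift U to NNReal using hU
  lift E to NNReal using hE
  norm_cast at *
  rw [← NNReal.coe_le_coe] at *
  push_cast at *
  linarith [U.coe_nonneg, E.coe_nonneg]

lemma setLIntegral_dyadicCube_le_stoppingRest {d : ℕ} {p : ℝ} (hp : 1 < p)
    {σ : (Fin d → ℝ) → ℝ} (hσ : IsWeight d σ) (q : ℤ × (Fin d → ℤ)) :
    ∫⁻ y in dyadicCube d q.1 q.2, ENNReal.ofReal (σ y) ≤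
      ENNReal.ofReal (2 ^ (p / (p - 1))) * ApChar d (p / (p - 1)) σ *
        ∫⁻ y in stoppingRest d σ q, ENNReal.ofReal (σ y) := by
  have hr : 0 < p / (p - 1) := div_pos (by linarith) (by linarith)
  have hV0 := volume_dyadicCube_ne_zero d q.1 q.2
  have hVt := volume_dyadicCube_ne_top d q.1 q.2
  have h := rpow_volume_mul_setLIntegral_le hp hσ.1 hσ.2.2 q.1 q.2
    (E := stoppingRest d σ q) sdiff_subset
  have hvol := volume_dyadicCube_le_stoppingRest hσ q
  set r := p / (p - 1)
  set V := volume (dyadicCube d q.1 q.2)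
  have hVr0 : V ^ r ≠ 0 := (ENNReal.rpow_pos (pos_iff_ne_zero.2 hV0) hVt).ne'
  have hVrt : V ^ r ≠ ⊤ := ENNReal.rpow_ne_top_of_nonneg hr.le hVt
  rw [← ENNReal.mul_le_mul_iff_right hVr0 hVrt]
  calc _ ≤ (2 * volume (stoppingRest d σ q)) ^ r *
        ∫⁻ y in dyadicCube d q.1 q.2, ENNReal.ofReal (σ y) := by gcongr
    _ = 2 ^ r * (volume (stoppingRest d σ q) ^ r *
        ∫⁻ y in dyadicCube d q.1 q.2, ENNReal.ofReal (σ y)) := by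
      rw [ENNReal.mul_rpow_of_nonneg _ _ hr.le, mul_assoc]
    _ ≤ 2 ^ r * (ApChar d r σ * V ^ r *
        ∫⁻ y in stoppingRest d σ q, ENNReal.ofReal (σ y)) := by gcongr
    _ = _ := by
      rw [← ENNReal.ofReal_rpow_of_pos (by norm_num : (0:ℝ) < 2), ENNReal.ofReal_ofNat]
      ring

lemma tsum_stoppingRest_add_tsum_stoppingGen_succ_le (d : ℕ) (σ : (Fin d → ℝ) → ℝ) (k : ℤ)
    (n : Fin d → ℤ) (j : ℕ) :
    (∑' q : stoppingGen d σ k n j, ∫⁻ y in stoppingRest d σ q, ENNReal.ofReal (σ y)) +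
        ∑' q : stoppingGen d σ k n (j + 1),
          ∫⁻ y in dyadicCube d q.1.1 q.1.2, ENNReal.ofReal (σ y) ≤
      ∑' q : stoppingGen d σ k n j, ∫⁻ y in dyadicCube d q.1.1 q.1.2, ENNReal.ofReal (σ y) := by
  have hgen : stoppingGen d σ k n (j + 1) =
      ⋃ q : stoppingGen d σ k n j, stoppingChildren d σ q := by
    ext r
    simp [stoppingGen, stoppingChildren]
  rw [← tsum_congr fun q : stoppingGen d σ k n j => setLIntegral_stoppingRest_add_tsum d σ q,
    ENNReal.tsum_add, hgen]
  gcongr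
  exact ENNReal.tsum_iUnion_le_tsum
    (fun r : ℤ × (Fin d → ℤ) => ∫⁻ y in dyadicCube d r.1 r.2, ENNReal.ofReal (σ y)) _

lemma ENNReal.tsum_le_of_add_succ_le {a e : ℕ → ℝ≥0∞} (h : ∀ j, e j + a (j + 1) ≤ a j) :
    ∑' j, e j ≤ a 0 := by
  have hN : ∀ N, ∑ j ∈ Finset.range N, e j + a N ≤ a 0 := fun N => by
    induction N with
    | zero => simp
    | succ N ih =>
      rw [Finset.sum_range_succ, add_assoc]
      exact (add_le_add_right (h N) _).trans ih
  exact ENNReal.tsum_le_of_sum_range_le fun N => le_self_add.trans (hN N)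

/-- **Carleson packing of the stopping cubes.** For `1 < p < ∞` with conjugate `p'`, there is
`C = C(p,d)` such that for every weight `σ ∈ A_{p'}` on `ℝ^d` and every dyadic cube `I₀`,
the stopping cubes `𝒮(I₀) = ⋃_j 𝒮_j(I₀)` satisfy
`Σ_{S ∈ 𝒮(I₀)} σ(S) ≤ C ‖σ‖_{A_{p'}} σ(I₀)`. -/
theorem stopping_cubes_carleson (d : ℕ) (p : ℝ) (hp : 1 < p) :
    ∃ C : ℝ, 0 < C ∧
      ∀ σ : (Fin d → ℝ) → ℝ, IsWeight d σ → ApChar d (p / (p - 1)) σ < ⊤ →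
        ∀ (k : ℤ) (n : Fin d → ℤ),
          ∑' q : (⋃ j : ℕ, stoppingGen d σ k n j),
              (∫⁻ y in dyadicCube d (q : ℤ × (Fin d → ℤ)).1 (q : ℤ × (Fin d → ℤ)).2,
                ENNReal.ofReal (σ y)) ≤
            ENNReal.ofReal C * ApChar d (p / (p - 1)) σ *
              ∫⁻ y in dyadicCube d k n, ENNReal.ofReal (σ y) := by
  refine ⟨2 ^ (p / (p - 1)), by positivity, fun σ hσ _ k n => ?_⟩
  set K := ENNReal.ofReal (2 ^ (p / (p - 1))) * ApChar d (p / (p - 1)) σ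
  have htele := ENNReal.tsum_le_of_add_succ_le
    (tsum_stoppingRest_add_tsum_stoppingGen_succ_le d σ k n)
  calc _ ≤ ∑' j, ∑' q : stoppingGen d σ k n j,
        ∫⁻ y in dyadicCube d q.1.1 q.1.2, ENNReal.ofReal (σ y) :=
        ENNReal.tsum_iUnion_le_tsum
          (fun r : ℤ × (Fin d → ℤ) => ∫⁻ y in dyadicCube d r.1 r.2, ENNReal.ofReal (σ y)) _
    _ ≤ ∑' j, ∑' q : stoppingGen d σ k n j,
        K * ∫⁻ y in stoppingRest d σ q, ENNReal.ofReal (σ y) :=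
        ENNReal.tsum_le_tsum fun j => ENNReal.tsum_le_tsum fun q =>
          setLIntegral_dyadicCube_le_stoppingRest hp hσ q
    _ = K * ∑' j, ∑' q : stoppingGen d σ k n j,
        ∫⁻ y in stoppingRest d σ q, ENNReal.ofReal (σ y) := by
        simp_rw [ENNReal.tsum_mul_left]
    _ ≤ K * ∑' q : stoppingGen d σ k n 0,
        ∫⁻ y in dyadicCube d q.1.1 q.1.2, ENNReal.ofReal (σ y) := by gcongr
    _ = _ := by
        congr 1
        exact tsum_singleton (k, n)
          (fun r : ℤ × (Fin d → ℤ) => ∫⁻ y in dyadicCube d r.1 r.2, ENNReal.ofReal (σ y))
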